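/- For every stable 3-pair network N there exists a feasible (s_1,s_2,s_3)–(t_1,t_2,t_3) multi-flow with rate (1,1,1); that is, the Langberg–Médard multiple unicast conjecture holds for stable 3-pair networks. -/

import Mathlib

open scoped BigOperators

/-- A `k`-pair network: a finite DAG with `k` sources of in-degree 0 and
`k` sinks of out-degree 0. -/
structure KPairNetwork (k : ℕ) where
  V : Type
  A : Type
  [fintypeV : Fintype V]
  [fintypeA : Fintype A]
  [decEqV : DecidableEq V]
  [decEqA : DecidableEq A]
  tail : A → V
  head : A → V
  /-- acyclicity, via a topological ordering of the vertices -/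
  acyclic : ∃ ord : V → ℕ, ∀ a : A, ord (tail a) < ord (head a)
  src : Fin k → V
  snk : Fin k → V
  src_inj : Function.Injective src
  snk_inj : Function.Injective snk
  src_no_in : ∀ (i : Fin k) (a : A), head a ≠ src i
  snk_no_out : ∀ (i : Fin k) (a : A), tail a ≠ snk i

attribute [instance] KPairNetwork.fintypeV KPairNetwork.fintypeA
attribute [instance] KPairNetwork.decEqV KPairNetwork.decEqA

namespace KPairNetwork

variable {k : ℕ} (N : KPairNetwork k)

/-- `l` is (the list of arcs of) a directed path from `u` to `v`. -/
def IsPathFrom (u v : N.V) (l : List N.A) : Prop :=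
  l ≠ [] ∧ l.Chain' (fun a b => N.head a = N.tail b) ∧
    (∀ a ∈ l.head?, N.tail a = u) ∧ (∀ a ∈ l.getLast?, N.head a = v)

/-- The vertices lying on a (nonempty) list of arcs. -/
def pathVerts (l : List N.A) : Set N.V :=
  {v | ∃ a ∈ l, v = N.tail a ∨ v = N.head a}

/-- `P i j` is a path from `s i` to `t j`, and for each sink `j` the `k`
paths `P · j` are pairwise arc-disjoint (strong reachability). -/
def IsStrongSystem (P : Fin k → Fin k → List N.A) : Prop :=
  (∀ i j, N.IsPathFrom (N.src i) (N.snk j) (P i j)) ∧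
    ∀ (j i i' : Fin k), i ≠ i' → ∀ a : N.A, a ∈ P i j → a ∉ P i' j

/-- Extra strong reachability: in addition, for each sink `j`, two distinct
paths towards `t j` share no vertex other than `t j`. -/
def IsExtraStrongSystem (P : Fin k → Fin k → List N.A) : Prop :=
  N.IsStrongSystem P ∧
    ∀ (j i i' : Fin k), i ≠ i' →
      ∀ v : N.V, v ∈ N.pathVerts (P i j) → v ∈ N.pathVerts (P i' j) → v = N.snk j

/-- Stability: the choice of the `k` pairwise arc-disjoint paths towards each
sink is unique. -/
def IsStableSystem (P : Fin k → Fin k → List N.A) : Prop :=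
  N.IsStrongSystem P ∧
    ∀ (j : Fin k) (Q : Fin k → List N.A),
      (∀ i, N.IsPathFrom (N.src i) (N.snk j) (Q i)) →
      (∀ i i', i ≠ i' → ∀ a : N.A, a ∈ Q i → a ∉ Q i') →
      ∀ i, Q i = P i j

/-- `excess_f(v) = Σ_{head a = v} f a − Σ_{tail a = v} f a`. -/
noncomputable def excess (f : N.A → ℝ) (v : N.V) : ℝ :=
  (∑ a : N.A, if N.head a = v then f a else 0) -
    (∑ a : N.A, if N.tail a = v then f a else 0)

/-- An `u`–`v` flow: zero excess away from `u` and `v`. -/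
def IsFlow (u v : N.V) (f : N.A → ℝ) : Prop :=
  ∀ w : N.V, w ≠ u → w ≠ v → N.excess f w = 0

/-- The unit flow along a path: `1` on its arcs and `0` elsewhere. -/
noncomputable def unitFlow (l : List N.A) : N.A → ℝ :=
  fun a => if a ∈ l then 1 else 0

/-- The set of source/sink index pairs whose path passes through the arc `a`. -/
def arcPattern (P : Fin k → Fin k → List N.A) (a : N.A) : Finset (Fin k × Fin k) :=
  Finset.univ.filter (fun q => a ∈ P q.1 q.2)

/-- `S_N`, the family of index-pair patterns of the arcs of `N`. -/
def SN (P : Fin k → Fin k → List N.A) : Set (Finset (Fin k × Fin k)) :=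
  {T | ∃ a : N.A, T = N.arcPattern P a}

/-! ### Segments and longest common segments -/

/-- A segment: a start vertex together with a (possibly empty) chained list of
arcs starting there.  A segment with no arcs is a single vertex. -/
def IsSeg (s : N.V × List N.A) : Prop :=
  s.2.Chain' (fun a b => N.head a = N.tail b) ∧ ∀ a ∈ s.2.head?, N.tail a = s.1

/-- The vertices of a segment. -/
def segVerts (s : N.V × List N.A) : Set N.V :=
  insert s.1 (N.pathVerts s.2)

/-- The final vertex of a segment. -/
def segEnd (s : N.V × List N.A) : N.V :=
  s.2.getLast?.elim s.1 N.head

/-- The segment `s` lies on the path `p`. -/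
def SegOn (s : N.V × List N.A) (p : List N.A) : Prop :=
  s.2 <:+: p ∧ s.1 ∈ N.pathVerts p

/-- The segment `s` is contained in the segment `s'`. -/
def SegLE (s s' : N.V × List N.A) : Prop :=
  s.2 <:+: s'.2 ∧ s.1 ∈ N.segVerts s'

/-- `s` is a longest common segment (l.c.s.) of the set of paths `ps`:
it is a segment common to all paths of `ps`, and no segment properly
containing it is common to all paths of `ps`. -/
def IsLCS (ps : Set (List N.A)) (s : N.V × List N.A) : Prop :=
  N.IsSeg s ∧ (∀ p ∈ ps, N.SegOn s p) ∧
    ∀ s' : N.V × List N.A, N.IsSeg s' → N.SegLE s s' → s' ≠ s →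
      ∃ p ∈ ps, ¬ N.SegOn s' p

/-- `s` is an l.c.s. of some pair `{P i j₁, P i' j₂}` and lies on `p`. -/
def IsPairLCSOn (P : Fin k → Fin k → List N.A) (j₁ j₂ : Fin k)
    (p : List N.A) (s : N.V × List N.A) : Prop :=
  (∃ i i' : Fin k, N.IsLCS {P i j₁, P i' j₂} s) ∧ N.SegOn s p

/-- `ℓ^{j₁,j₂}(p)`: the number of l.c.s.'s of pairs `{P i j₁, P i' j₂}` lying
on the path `p`. -/
noncomputable def lcsCount (P : Fin k → Fin k → List N.A) (j₁ j₂ : Fin k)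
    (p : List N.A) : ℕ :=
  Nat.card {s : N.V × List N.A | N.IsPairLCSOn P j₁ j₂ p s}

/-- `m_{j₁,j₂}^c = {i : ℓ^{j₁,j₂}(P_{s_i,t_c}) = 1}`. -/
def mset (P : Fin k → Fin k → List N.A) (j₁ j₂ c : Fin k) : Set (Fin k) :=
  {i | N.lcsCount P j₁ j₂ (P i c) = 1}

/-- `u` lies strictly before `v` along the path `p` (there is a nonempty
infix of `p` going from `u` to `v`). -/
def StrictlyBeforeOn (p : List N.A) (u v : N.V) : Prop :=
  ∃ l : List N.A, l <:+: p ∧ l.head?.map N.tail = some u ∧ l.getLast?.map N.head = some v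

/-- `e 0, …, e (L-1)` enumerates, in the order along `p`, the l.c.s.'s
`p(1) < p(2) < ⋯ < p(L)` of pairs `{P i j₁, P i' j₂}` lying on `p`. -/
def IsLCSEnum (P : Fin k → Fin k → List N.A) (j₁ j₂ : Fin k) (p : List N.A)
    (e : ℕ → N.V × List N.A) (L : ℕ) : Prop :=
  (∀ n, n < L → N.IsPairLCSOn P j₁ j₂ p (e n)) ∧
  (∀ s, N.IsPairLCSOn P j₁ j₂ p s → ∃ n, n < L ∧ e n = s) ∧
  (∀ m n, m < n → n < L → N.StrictlyBeforeOn p (N.segEnd (e m)) (e n).1)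

/-! ### Residual networks, regular cycles, semi-cycles and crossings -/

/-- `a` is a `P_{t_j}`-arc. -/
def isPArc (P : Fin k → Fin k → List N.A) (j : Fin k) (a : N.A) : Prop :=
  ∃ i, a ∈ P i j

/-- The tail of `a` in the `j`-th residual network `N_j` (in which all
`P_{t_j}`-arcs are reversed). -/
def rtail (P : Fin k → Fin k → List N.A) (j : Fin k) (a : N.A) : N.V :=
  if ∃ i, a ∈ P i j then N.head a else N.tail a

/-- The head of `a` in the `j`-th residual network `N_j`. -/
def rhead (P : Fin k → Fin k → List N.A) (j : Fin k) (a : N.A) : N.V :=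
  if ∃ i, a ∈ P i j then N.tail a else N.head a

/-- `l` is a directed cycle of the residual network `N_j`. -/
def IsResidCycle (P : Fin k → Fin k → List N.A) (j : Fin k) (l : List N.A) : Prop :=
  l ≠ [] ∧ l.Nodup ∧
  l.Chain' (fun a b => N.rhead P j a = N.rtail P j b) ∧
  (∀ a ∈ l.getLast?, ∀ b ∈ l.head?, N.rhead P j a = N.rtail P j b) ∧
  (l.map (N.rtail P j)).Nodup

/-- A regular cycle of `N_j`: a directed cycle of `N_j` having no isolated
vertex of `P_{t_j}`, i.e. every vertex of the cycle lying on a path of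
`P_{t_j}` is incident in the cycle to some (reversed) `P_{t_j}`-arc. -/
def IsRegularCycle (P : Fin k → Fin k → List N.A) (j : Fin k) (l : List N.A) : Prop :=
  N.IsResidCycle P j l ∧
    ∀ v ∈ l.map (N.rtail P j),
      (∃ i, v ∈ N.pathVerts (P i j)) →
      ∃ a ∈ l, N.isPArc P j a ∧ (v = N.tail a ∨ v = N.head a)

/-- A `P_{t_j}`-semi-cycle of `N`: the arc set of a regular cycle of `N_j`,
with the original orientations of `N` restored. -/
def IsSemiCycle (P : Fin k → Fin k → List N.A) (j : Fin k) (E : Set N.A) : Prop :=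
  ∃ l : List N.A, N.IsRegularCycle P j l ∧ E = {a | a ∈ l}

/-- A `P_{t_j}`-crossing of `N`: a `P_{t_j}`-semi-cycle with all its
`P_{t_j}`-arcs removed. -/
def IsCrossing (P : Fin k → Fin k → List N.A) (j : Fin k) (E : Set N.A) : Prop :=
  ∃ l : List N.A, N.IsRegularCycle P j l ∧ E = {a | a ∈ l ∧ ¬ N.isPArc P j a}

end KPairNetwork

namespace KPairNetwork

section Paths

variable {k : ℕ} {N : KPairNetwork k} {u v w : N.V} {l : List N.A} {a b : N.A}

/-- A topological ordering of the vertices. -/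
noncomputable def ord (N : KPairNetwork k) : N.V → ℕ := N.acyclic.choose

theorem ord_lt (N : KPairNetwork k) (a : N.A) : N.ord (N.tail a) < N.ord (N.head a) :=
  N.acyclic.choose_spec a

theorem IsPathFrom.nil (h : N.IsPathFrom u v []) : False := h.1 rfl

theorem IsPathFrom.tail_eq (h : N.IsPathFrom u v (a :: l)) : N.tail a = u := h.2.2.1 a (by simp)

theorem isPathFrom_singleton (a : N.A) : N.IsPathFrom (N.tail a) (N.head a) [a] := by
  refine ⟨by simp, List.isChain_singleton _, ?_, ?_⟩ <;> simp

theorem isPathFrom_cons_iff (hl : l ≠ []) :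
    N.IsPathFrom u v (a :: l) ↔ N.tail a = u ∧ N.IsPathFrom (N.head a) v l := by
  obtain ⟨b, l, rfl⟩ := List.exists_cons_of_ne_nil hl
  simp only [IsPathFrom, List.Chain', List.isChain_cons_cons, ne_eq, reduceCtorEq, not_false_eq_true,
    true_and, List.head?_cons, Option.mem_def, Option.some.injEq, forall_eq',
    List.getLast?_cons_cons]
  constructor
  · rintro ⟨⟨h, h'⟩, h1, h2⟩
    exact ⟨h1, h', h.symm, h2⟩
  · rintro ⟨h, h', h1, h2⟩
    exact ⟨⟨h1.symm, h'⟩, h, h2⟩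

/-- Induction on paths, adding arcs at the front. -/
theorem IsPathFrom.induction_on {v : N.V}
    {motive : (u : N.V) → (l : List N.A) → N.IsPathFrom u v l → Prop}
    (single : ∀ a h, N.head a = v → motive (N.tail a) [a] h)
    (cons : ∀ a l h (hl : N.IsPathFrom (N.head a) v l), motive (N.head a) l hl →
      motive (N.tail a) (a :: l) h)
    {u : N.V} {l : List N.A} (h : N.IsPathFrom u v l) : motive u l h := by
  induction l generalizing u with
  | nil => exact h.nil.elim
  | cons a l ih =>
    obtain rfl := h.tail_eq
    rcases eq_or_ne l [] with rfl | hl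
    · exact single a h (h.2.2.2 a (by simp))
    · have h2 := ((isPathFrom_cons_iff hl).1 h).2
      exact cons a l h h2 (ih h2)

theorem IsPathFrom.ord_le (h : N.IsPathFrom u v l) : ∀ a ∈ l, N.ord u ≤ N.ord (N.tail a) := by
  induction h using IsPathFrom.induction_on with
  | single a _ ha => simp
  | cons a l _ hl ih =>
    intro b hb
    rcases List.mem_cons.1 hb with rfl | hb
    · rfl
    · exact (N.ord_lt a).le.trans (ih b hb)

/-- Two arcs of a path are equal or separated, and a potential which is monotone along the path
decreases from the first of them to the second. -/
theorem IsPathFrom.comparable (h : N.IsPathFrom u v l) {p : N.V → ℕ}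
    (hp : ∀ a ∈ l, p (N.head a) ≤ p (N.tail a)) (ha : a ∈ l) (hb : b ∈ l) :
    a = b ∨ (N.ord (N.head a) ≤ N.ord (N.tail b) ∧ p (N.tail b) ≤ p (N.head a)) ∨
      (N.ord (N.head b) ≤ N.ord (N.tail a) ∧ p (N.tail a) ≤ p (N.head b)) := by
  suffices key : l.Pairwise (fun a b => N.ord (N.head a) ≤ N.ord (N.tail b) ∧
      p (N.tail b) ≤ p (N.head a)) ∧ ∀ a ∈ l, p (N.tail a) ≤ p u by
    have := key.1
    rw [List.pairwise_iff_getElem] at this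
    obtain ⟨i, hi, rfl⟩ := List.getElem_of_mem ha
    obtain ⟨j, hj, rfl⟩ := List.getElem_of_mem hb
    rcases lt_trichotomy i j with hij | rfl | hij
    · exact Or.inr (Or.inl (this i j hi hj hij))
    · exact Or.inl rfl
    · exact Or.inr (Or.inr (this j i hj hi hij))
  clear ha hb
  induction h using IsPathFrom.induction_on with
  | single a _ ha => simp
  | cons a l _ hl ih =>
    obtain ⟨h1, h2⟩ := ih fun b hb => hp b (List.mem_cons_of_mem _ hb)
    refine ⟨List.pairwise_cons.2 ⟨fun b hb => ⟨hl.ord_le b hb, h2 b hb⟩, h1⟩, fun b hb => ?_⟩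
    rcases List.mem_cons.1 hb with rfl | hb
    · rfl
    · exact (h2 b hb).trans (hp a (by simp))

theorem IsPathFrom.eq_or_ord_le (h : N.IsPathFrom u v l) (ha : a ∈ l) (hb : b ∈ l) :
    a = b ∨ N.ord (N.head a) ≤ N.ord (N.tail b) ∨ N.ord (N.head b) ≤ N.ord (N.tail a) := by
  simpa using h.comparable (p := fun _ => 0) (fun _ _ => le_rfl) ha hb

theorem IsPathFrom.eq_of_ord_tail_eq (h : N.IsPathFrom u v l) (ha : a ∈ l) (hb : b ∈ l)
    (hab : N.ord (N.tail a) = N.ord (N.tail b)) : a = b := by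
  have h1 := N.ord_lt a
  have h2 := N.ord_lt b
  rcases h.eq_or_ord_le ha hb with h | h | h
  · exact h
  · omega
  · omega

theorem IsPathFrom.exists_head_eq_tail (h : N.IsPathFrom u v l) (ha : a ∈ l) :
    N.tail a = u ∨ ∃ b ∈ l, N.head b = N.tail a := by
  induction h using IsPathFrom.induction_on with
  | single b _ hb => simp_all
  | cons b l _ hl ih =>
    rcases List.mem_cons.1 ha with rfl | ha
    · exact Or.inl rfl
    · rcases ih ha with h | ⟨c, hc, h⟩
      · exact Or.inr ⟨b, by simp, h.symm⟩
      · exact Or.inr ⟨c, List.mem_cons_of_mem _ hc, h⟩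

theorem IsPathFrom.exists_tail_eq_head (h : N.IsPathFrom u v l) (ha : a ∈ l) :
    N.head a = v ∨ ∃ b ∈ l, N.tail b = N.head a := by
  induction h using IsPathFrom.induction_on with
  | single b _ hb => simp_all
  | cons b l _ hl ih =>
    rcases List.mem_cons.1 ha with rfl | ha
    · obtain ⟨c, l, rfl⟩ := List.exists_cons_of_ne_nil hl.1
      exact Or.inr ⟨c, by simp, hl.tail_eq⟩
    · rcases ih ha with h | ⟨c, hc, h⟩
      · exact Or.inl h
      · exact Or.inr ⟨c, List.mem_cons_of_mem _ hc, h⟩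

theorem IsPathFrom.exists_head_eq (h : N.IsPathFrom u v l) : ∃ a ∈ l, N.head a = v := by
  induction h using IsPathFrom.induction_on with
  | single b _ hb => exact ⟨b, by simp, hb⟩
  | cons b l _ hl ih =>
    obtain ⟨a, ha, h⟩ := ih
    exact ⟨a, List.mem_cons_of_mem _ ha, h⟩

theorem IsPathFrom.exists_tail_eq (h : N.IsPathFrom u v l) (hw : w ∈ N.pathVerts l) (hwv : w ≠ v) :
    ∃ a ∈ l, N.tail a = w := by
  obtain ⟨a, ha, rfl | rfl⟩ := hw
  · exact ⟨a, ha, rfl⟩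
  · exact (h.exists_tail_eq_head ha).resolve_left hwv

theorem tail_mem_pathVerts (ha : a ∈ l) : N.tail a ∈ N.pathVerts l := ⟨a, ha, Or.inl rfl⟩

theorem head_mem_pathVerts (ha : a ∈ l) : N.head a ∈ N.pathVerts l := ⟨a, ha, Or.inr rfl⟩

/-- Following a path up to a vertex and then another path from that vertex on. -/
theorem IsPathFrom.splice {u' v' : N.V} {p s p' s' : List N.A}
    (h : N.IsPathFrom u v (p ++ a :: s)) (h' : N.IsPathFrom u' v' (p' ++ b :: s'))
    (hab : N.tail a = N.tail b) : N.IsPathFrom u v' (p ++ b :: s') := by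
  obtain ⟨-, h1, h2, -⟩ := h
  obtain ⟨-, h1', -, h3⟩ := h'
  refine ⟨by simp, ?_, ?_, ?_⟩
  · simp only [List.Chain', List.isChain_append, List.head?_cons, Option.mem_def,
      Option.some.injEq, forall_eq'] at h1 h1' ⊢
    exact ⟨h1.1, h1'.2.1, fun x hx => (h1.2.2 x hx).trans hab⟩
  · cases p <;> simp_all
  · simpa [List.getLast?_append] using h3

theorem IsPathFrom.drop {p s : List N.A} (h : N.IsPathFrom u v (p ++ a :: s)) :
    N.IsPathFrom (N.tail a) v (a :: s) :=
  IsPathFrom.splice (p := []) (s := []) (isPathFrom_singleton a) h rfl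

theorem IsPathFrom.ord_tail_le {p s : List N.A} (h : N.IsPathFrom u v (p ++ a :: s))
    (hb : b ∈ a :: s) :
    N.ord (N.tail a) ≤ N.ord (N.tail b) :=
  h.drop.ord_le b hb

theorem IsPathFrom.ord_tail_lt {p s : List N.A} (h : N.IsPathFrom u v (p ++ a :: s)) (hb : b ∈ p) :
    N.ord (N.tail b) < N.ord (N.tail a) := by
  obtain ⟨q, r, rfl⟩ := List.append_of_mem hb
  rw [List.append_assoc, List.cons_append] at h
  have := ((isPathFrom_cons_iff (by simp)).1 h.drop).2.ord_le a (by simp)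
  exact (N.ord_lt b).trans_le this

end Paths

section Excess

variable {k : ℕ} {N : KPairNetwork k} {u v w : N.V} {l : List N.A} {a b : N.A}

theorem excess_add (f g : N.A → ℝ) (v : N.V) :
    N.excess (f + g) v = N.excess f v + N.excess g v := by
  simp only [excess, Pi.add_apply, ← Finset.sum_filter, Finset.sum_add_distrib]
  ring

theorem excess_smul (c : ℝ) (f : N.A → ℝ) (v : N.V) :
    N.excess (c • f) v = c * N.excess f v := by
  simp only [excess, Pi.smul_apply, smul_eq_mul, ← Finset.sum_filter, ← Finset.mul_sum]
  ring

theorem excess_sub (f g : N.A → ℝ) (v : N.V) :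
    N.excess (f - g) v = N.excess f v - N.excess g v := by
  rw [sub_eq_add_neg, excess_add, ← neg_one_smul ℝ g, excess_smul]
  ring

theorem excess_sum {ι : Type*} (s : Finset ι) (f : ι → N.A → ℝ) (v : N.V) :
    N.excess (∑ i ∈ s, f i) v = ∑ i ∈ s, N.excess (f i) v := by
  classical
  induction s using Finset.induction_on with
  | empty => simp [excess]
  | insert i s hi ih => rw [Finset.sum_insert hi, Finset.sum_insert hi, excess_add, ih]

theorem excess_single (a : N.A) (v : N.V) :
    N.excess (Pi.single a 1) v =
      (if v = N.head a then 1 else 0) - (if v = N.tail a then 1 else 0) := by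
  classical
  have key : ∀ g : N.A → N.V, (∑ b, if g b = v then (Pi.single a 1 : N.A → ℝ) b else 0) =
      if v = g a then 1 else 0 := by
    intro g
    rw [Finset.sum_eq_single a]
    · simp [eq_comm]
    · intro b _ hb
      simp [hb]
    · simp
  rw [excess, key, key]

theorem IsPathFrom.excess_unitFlow (h : N.IsPathFrom u v l) (w : N.V) :
    N.excess (N.unitFlow l) w = (if w = v then 1 else 0) - (if w = u then 1 else 0) := by
  classical
  induction h using IsPathFrom.induction_on with
  | single a _ ha =>
    have : N.unitFlow [a] = Pi.single a 1 := by
      funext b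
      simp [unitFlow, Pi.single_apply]
    rw [this, excess_single, ha]
  | cons a l _ hl ih =>
    have : N.unitFlow (a :: l) = Pi.single a 1 + N.unitFlow l := by
      funext b
      have hal : a ∉ l := fun hal => absurd (hl.ord_le a hal) (not_le.2 (N.ord_lt a))
      by_cases hb : b = a
      · subst hb
        simp [unitFlow, hal]
      · simp [unitFlow, hb]
    rw [this, excess_add, excess_single, ih]
    ring

end Excess

end KPairNetwork

namespace KPairNetwork

section Decomposition

variable {k : ℕ} {N : KPairNetwork k} {s t v : N.V} {B : Finset N.A} {a : N.A}

/-- The indicator function of a set of arcs. -/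
noncomputable def ind (B : Finset N.A) : N.A → ℝ := fun a => if a ∈ B then 1 else 0

theorem exists_tail_eq_of_excess_neg (h : N.excess (ind B) v < 0) : ∃ b ∈ B, N.tail b = v := by
  by_contra! hb
  have h1 : ∑ a, (if N.tail a = v then ind B a else 0) = 0 := by
    refine Finset.sum_eq_zero fun a _ => ?_
    by_cases ha : a ∈ B
    · simp [hb a ha]
    · simp [ind, ha]
  have h2 : 0 ≤ ∑ a, (if N.head a = v then ind B a else 0) := by
    refine Finset.sum_nonneg fun a _ => ?_
    unfold ind
    split_ifs <;> norm_num
  rw [excess, h1] at h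
  linarith

theorem exists_tail_eq_head (ha : a ∈ B) (h : N.excess (ind B) (N.head a) ≤ 0) :
    ∃ b ∈ B, N.tail b = N.head a := by
  by_contra! hb
  have h1 : ∑ b, (if N.tail b = N.head a then ind B b else 0) = 0 := by
    refine Finset.sum_eq_zero fun b _ => ?_
    by_cases hbB : b ∈ B
    · simp [hb b hbB]
    · simp [ind, hbB]
  have h2 : (if N.head a = N.head a then ind B a else 0) ≤
      ∑ b, (if N.head b = N.head a then ind B b else 0) := by
    refine Finset.single_le_sum (f := fun b => if N.head b = N.head a then ind B b else 0)
      (fun b _ => ?_) (Finset.mem_univ a)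
    dsimp only [ind]
    split_ifs <;> norm_num
  simp only [if_true] at h2
  have h3 : ind B a = 1 := by simp [ind, ha]
  rw [excess, h1] at h
  linarith

theorem exists_path_of_excess (hB : ∀ v ≠ t, N.excess (ind B) v ≤ 0) (ha : a ∈ B) :
    ∃ l, N.IsPathFrom (N.tail a) t l ∧ ∀ b ∈ l, b ∈ B := by
  set M := Finset.univ.sup fun a => N.ord (N.head a) with hM
  have hle : ∀ a, N.ord (N.head a) ≤ M := fun a =>
    Finset.le_sup (f := fun a => N.ord (N.head a)) (Finset.mem_univ a)
  induction hn : M - N.ord (N.head a) using Nat.strong_induction_on generalizing a with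
  | _ n ih =>
    by_cases hat : N.head a = t
    · exact ⟨[a], hat ▸ isPathFrom_singleton a, by simpa using ha⟩
    · obtain ⟨b, hb, hba⟩ := exists_tail_eq_head ha (hB _ hat)
      have h1 := N.ord_lt b
      have h2 := hle b
      rw [hba] at h1
      obtain ⟨l, hl, hlB⟩ := ih _ (by omega) hb rfl
      refine ⟨a :: l, (isPathFrom_cons_iff hl.1).2 ⟨rfl, hba ▸ hl⟩, ?_⟩
      simpa using ⟨ha, hlB⟩

theorem eq_empty_of_excess (hB : ∀ v, N.excess (ind B) v ≤ 0) : B = ∅ := by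
  by_contra hne
  obtain ⟨a, ha, hmax⟩ := Finset.exists_max_image B (fun a => N.ord (N.head a))
    (Finset.nonempty_iff_ne_empty.2 hne)
  obtain ⟨b, hb, hba⟩ := exists_tail_eq_head ha (hB _)
  have h1 := N.ord_lt b
  have h2 := hmax b hb
  rw [hba] at h1
  exact absurd h1 (not_lt.2 h2)

theorem exists_peel {g : N.V → ℝ} (hB : ∀ v, N.excess (ind B) v = g v)
    (hg : ∀ v ≠ t, g v ≤ 0) (hs : g s < 0) :
    ∃ l, ∃ B' : Finset N.A, N.IsPathFrom s t l ∧ (∀ a ∈ l, a ∈ B) ∧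
      (∀ a, a ∈ B ↔ a ∈ l ∨ a ∈ B') ∧ (∀ a ∈ B', a ∉ l) ∧
      ∀ v, N.excess (ind B') v =
        g v - ((if v = t then 1 else 0) - (if v = s then 1 else 0)) := by
  classical
  obtain ⟨a, ha, rfl⟩ := exists_tail_eq_of_excess_neg (hB s ▸ hs)
  obtain ⟨l, hl, hlB⟩ := exists_path_of_excess (t := t) (fun v hv => hB v ▸ hg v hv) ha
  refine ⟨l, B.filter (· ∉ l), hl, hlB, fun b => ?_, by simp, fun v => ?_⟩
  · have := hlB b
    simp only [Finset.mem_filter]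
    tauto
  · have : ind (B.filter (· ∉ l)) = ind B - N.unitFlow l := by
      funext b
      have := hlB b
      by_cases h1 : b ∈ l
      · simp [ind, unitFlow, h1, this h1]
      · simp [ind, unitFlow, h1]
    rw [this, excess_sub, hB, hl.excess_unitFlow]

end Decomposition

section Residual

variable {N : KPairNetwork 3} {P : Fin 3 → Fin 3 → List N.A}

theorem IsStableSystem.path (hP : N.IsStableSystem P) (i j : Fin 3) :
    N.IsPathFrom (N.src i) (N.snk j) (P i j) := hP.1.1 i j

theorem IsStableSystem.disjoint (hP : N.IsStableSystem P) {i i' j : Fin 3} {a : N.A}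
    (h : a ∈ P i j) (h' : a ∈ P i' j) : i = i' := by
  by_contra hne
  exact hP.1.2 j i i' hne a h h'

theorem IsStableSystem.src_ne_snk (hP : N.IsStableSystem P) (i j : Fin 3) :
    N.src i ≠ N.snk j := by
  obtain ⟨a, -, ha⟩ := (hP.path i j).exists_head_eq
  exact fun h => N.src_no_in i a (ha.trans h.symm)

/-- A set of arcs with the same excess as the union of the paths to the `j`-th sink is this
union. -/
theorem IsStableSystem.mem_iff_of_excess (hP : N.IsStableSystem P) (j : Fin 3) {B : Finset N.A}
    (hB : ∀ v, N.excess (ind B) v =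
      ∑ i, ((if v = N.snk j then 1 else 0) - (if v = N.src i then 1 else 0))) (a : N.A) :
    a ∈ B ↔ ∃ i, a ∈ P i j := by
  have hst := hP.src_ne_snk
  have hs : ∀ i i', N.src i = N.src i' ↔ i = i' := fun i i' => N.src_inj.eq_iff
  simp only [Fin.sum_univ_three] at hB
  obtain ⟨l₀, B₀, h₀, hl₀, hm₀, hd₀, hB₀⟩ := exists_peel (s := N.src 0) (t := N.snk j) hB
    (fun v hv => by simp only [hv, if_false]; split_ifs <;> norm_num)
    (by simp [hst, hs])
  obtain ⟨l₁, B₁, h₁, hl₁, hm₁, hd₁, hB₁⟩ := exists_peel (s := N.src 1) (t := N.snk j) hB₀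
    (fun v hv => by simp only [hv, if_false]; split_ifs <;> norm_num)
    (by simp [hst, hs])
  obtain ⟨l₂, B₂, h₂, hl₂, hm₂, hd₂, hB₂⟩ := exists_peel (s := N.src 2) (t := N.snk j) hB₁
    (fun v hv => by simp only [hv, if_false]; split_ifs <;> norm_num)
    (by simp [hst, hs])
  have hempty : B₂ = ∅ := eq_empty_of_excess fun v => by rw [hB₂]; linarith
  have d₁₀ : ∀ b ∈ l₁, b ∉ l₀ := fun b hb => hd₀ b (hl₁ b hb)
  have d₂₀ : ∀ b ∈ l₂, b ∉ l₀ := fun b hb => hd₀ b ((hm₁ b).2 (Or.inr (hl₂ b hb)))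
  have d₂₁ : ∀ b ∈ l₂, b ∉ l₁ := fun b hb => hd₁ b (hl₂ b hb)
  have hQ := hP.2 j ![l₀, l₁, l₂] (Fin.forall_fin_succ.2 ⟨h₀, Fin.forall_fin_two.2 ⟨h₁, h₂⟩⟩) (by
    intro i i' hne b hb hb'
    fin_cases i <;> fin_cases i'
    · exact hne rfl
    · exact d₁₀ b hb' hb
    · exact d₂₀ b hb' hb
    · exact d₁₀ b hb hb'
    · exact hne rfl
    · exact d₂₁ b hb' hb
    · exact d₂₀ b hb hb'
    · exact d₂₁ b hb hb'
    · exact hne rfl)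
  have q₀ := hQ 0
  have q₁ := hQ 1
  have q₂ := hQ 2
  simp only [Matrix.cons_val] at q₀ q₁ q₂
  rw [hm₀, hm₁, hm₂, hempty, Fin.exists_fin_succ, Fin.exists_fin_two]
  simp [q₀, q₁, q₂]

/-- Two paths to the same sink meet only in this sink. -/
theorem IsStableSystem.eq_of_mem_pathVerts (hP : N.IsStableSystem P) {i i' j : Fin 3} {v : N.V}
    (hv : v ∈ N.pathVerts (P i j)) (hv' : v ∈ N.pathVerts (P i' j)) (hvt : v ≠ N.snk j) :
    i = i' := by
  by_contra hne
  obtain ⟨a, ha, rfl⟩ := (hP.path i j).exists_tail_eq hv hvt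
  obtain ⟨b, hb, hab⟩ := (hP.path i' j).exists_tail_eq hv' hvt
  obtain ⟨p, s, hps⟩ := List.append_of_mem ha
  obtain ⟨p', s', hps'⟩ := List.append_of_mem hb
  have h1 := hP.path i j
  have h2 := hP.path i' j
  rw [hps] at h1
  rw [hps'] at h2
  have hx := h1.splice h2 hab.symm
  have hy := h2.splice h1 hab
  have m1 : ∀ x, x ∈ P i j ↔ x ∈ p ∨ x ∈ a :: s := fun x => by rw [hps, List.mem_append]
  have m2 : ∀ x, x ∈ P i' j ↔ x ∈ p' ∨ x ∈ b :: s' := fun x => by rw [hps', List.mem_append]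
  have o1 : ∀ x ∈ p, x ∉ a :: s := fun x hx hx' =>
    absurd (h1.ord_tail_le hx') (not_le.2 (h1.ord_tail_lt hx))
  have o2 : ∀ x ∈ p', x ∉ b :: s' := fun x hx hx' =>
    absurd (h2.ord_tail_le hx') (not_le.2 (h2.ord_tail_lt hx))
  have hQ := hP.2 j (fun m => if m = i then p ++ b :: s' else if m = i' then p' ++ a :: s else P m j)
    (fun m => by
      split_ifs with hm hm'
      · exact hm ▸ hx
      · exact hm' ▸ hy
      · exact hP.path m j)
    (fun m m' hmm x hxm hxm' => by
      have d : ∀ {m m'}, x ∈ P m j → x ∈ P m' j → m = m' := hP.disjoint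
      have := m1 x
      have := m2 x
      have := o1 x
      have := o2 x
      split_ifs at hxm hxm' <;> grind) i
  simp only [if_true] at hQ
  exact hne (hP.disjoint (a := b) (by rw [← hQ]; simp) hb)

/-- The arcs of the paths to the `j`-th sink. -/
noncomputable def sinkArcs (P : Fin 3 → Fin 3 → List N.A) (j : Fin 3) : Finset N.A :=
  Finset.univ.filter fun a => ∃ i, a ∈ P i j

theorem mem_sinkArcs {j : Fin 3} {a : N.A} : a ∈ sinkArcs P j ↔ ∃ i, a ∈ P i j := by
  simp [sinkArcs]

theorem IsStableSystem.excess_sinkArcs (hP : N.IsStableSystem P) (j : Fin 3) (v : N.V) :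
    N.excess (ind (sinkArcs P j)) v =
      ∑ i, ((if v = N.snk j then 1 else 0) - (if v = N.src i then 1 else 0)) := by
  have : ind (sinkArcs P j) = ∑ i, N.unitFlow (P i j) := by
    funext a
    rw [Finset.sum_apply]
    by_cases ha : ∃ i, a ∈ P i j
    · obtain ⟨i, hi⟩ := ha
      rw [Finset.sum_eq_single i]
      · simp [ind, unitFlow, hi, mem_sinkArcs.2 ⟨i, hi⟩]
      · intro i' _ hne
        have : a ∉ P i' j := fun h => hne (hP.disjoint h hi)
        simp [unitFlow, this]
      · simp
    · rw [Finset.sum_eq_zero]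
      · simp only [ind, mem_sinkArcs, ha, if_false]
      · intro i _
        have : a ∉ P i j := fun h => ha ⟨i, h⟩
        simp [unitFlow, this]
  rw [this, excess_sum]
  exact Finset.sum_congr rfl fun i _ => (hP.path i j).excess_unitFlow v

/-- The steps of the `j`-th residual network. -/
def ResidStep (P : Fin 3 → Fin 3 → List N.A) (j : Fin 3) (u v : N.V) : Prop :=
  ∃ a, N.rtail P j a = u ∧ N.rhead P j a = v

/-- The residual networks of a stable system are acyclic. -/
theorem IsStableSystem.not_transGen_residStep (hP : N.IsStableSystem P) (j : Fin 3) (v : N.V) :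
    ¬ Relation.TransGen (ResidStep P j) v v := by
  classical
  intro hv
  let S := {v : N.V // Relation.TransGen (ResidStep P j) v v}
  have hstep : ∀ v : S, ∃ a, ∃ w : S, N.rtail P j a = v ∧ N.rhead P j a = w := by
    rintro ⟨v, hv⟩
    obtain ⟨w, ⟨a, ha, haw⟩, hwv⟩ := Relation.TransGen.head'_iff.1 hv
    exact ⟨a, ⟨w, Relation.TransGen.tail' hwv ⟨a, ha, haw⟩⟩, ha, haw⟩
  choose c g hc hg using hstep
  have hbij := Function.bijOn_periodicPts g
  set Z := (Function.periodicPts g).toFinset with hZ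
  have hZc : (Z : Set S) = Function.periodicPts g := by simp [hZ]
  rw [← hZc] at hbij
  have hcinj : ∀ y z, c y = c z → y = z := fun y z h => Subtype.ext (by rw [← hc, ← hc, h])
  let sgn : N.A → ℝ := fun a => if a ∈ sinkArcs P j then -1 else 1
  have hflow : ∀ v, N.excess (∑ z ∈ Z, sgn (c z) • Pi.single (c z) (1 : ℝ)) v = 0 := by
    intro v
    have h1 : ∀ z, N.excess (sgn (c z) • Pi.single (c z) (1 : ℝ)) v =
        (if v = g z then 1 else 0) - (if v = z then 1 else 0) := by
      intro z
      rw [excess_smul, excess_single, ← hg, ← hc]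
      by_cases hz : ∃ i, c z ∈ P i j
      · simp only [sgn, mem_sinkArcs, rhead, rtail, if_pos hz]
        ring
      · simp only [sgn, mem_sinkArcs, rhead, rtail, if_neg hz]
        ring
    rw [excess_sum, Finset.sum_congr rfl fun z _ => h1 z, Finset.sum_sub_distrib, sub_eq_zero]
    exact Finset.sum_nbij g (fun z hz => hbij.mapsTo hz) hbij.injOn hbij.surjOn fun z _ => rfl
  let B := symmDiff (sinkArcs P j) (Z.image c)
  have hB : ind B = ind (sinkArcs P j) + ∑ z ∈ Z, sgn (c z) • Pi.single (c z) (1 : ℝ) := by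
    funext a
    rw [Pi.add_apply, Finset.sum_apply]
    by_cases ha : a ∈ Z.image c
    · obtain ⟨y, hy, rfl⟩ := Finset.mem_image.1 ha
      rw [Finset.sum_eq_single y]
      · by_cases hz : c y ∈ sinkArcs P j
        · simp [ind, B, Finset.mem_symmDiff, ha, hz, sgn]
        · simp only [ind, B, Finset.mem_symmDiff, ha, hz, sgn]
          simp
      · intro z _ hzy
        have : c y ≠ c z := fun h => hzy (hcinj _ _ h).symm
        simp [this]
      · exact fun h => (h hy).elim
    · rw [Finset.sum_eq_zero]
      · simp only [ind, B, Finset.mem_symmDiff, ha]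
        simp
      · intro z hz
        have : a ≠ c z := fun h => ha (h ▸ Finset.mem_image_of_mem c hz)
        simp [this]
  have hmem := hP.mem_iff_of_excess j (B := B) fun v => by
    rw [hB, excess_add, hflow, add_zero, hP.excess_sinkArcs]
  obtain ⟨z, hz⟩ : ∃ z, z ∈ Function.periodicPts g := by
    obtain ⟨m, n, hmn, h⟩ := Finite.exists_ne_map_eq_of_infinite fun n : ℕ => g^[n] ⟨v, hv⟩
    wlog hlt : m < n generalizing m n
    · exact this n m hmn.symm h.symm (by omega)
    refine ⟨g^[m] ⟨v, hv⟩, Function.mk_mem_periodicPts (n := n - m) (by omega) ?_⟩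
    rw [Function.IsPeriodicPt, Function.IsFixedPt, ← Function.iterate_add_apply, h]
    congr 2
    omega
  have hzZ : c z ∈ Z.image c := Finset.mem_image_of_mem c (by simpa [hZ] using hz)
  have := hmem (c z)
  rw [← mem_sinkArcs, Finset.mem_symmDiff] at this
  tauto

/-- A potential increasing along the arcs of the `j`-th residual network. -/
theorem IsStableSystem.exists_potential (hP : N.IsStableSystem P) (j : Fin 3) :
    ∃ p : N.V → ℕ, (∀ a, (∃ i, a ∈ P i j) → p (N.head a) < p (N.tail a)) ∧
      ∀ a, (¬ ∃ i, a ∈ P i j) → p (N.tail a) < p (N.head a) := by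
  classical
  let p : N.V → ℕ := fun v => (Finset.univ.filter fun u =>
    Relation.TransGen (ResidStep P j) u v).card
  have hp : ∀ u v, ResidStep P j u v → p u < p v := by
    intro u v huv
    refine Finset.card_lt_card (Finset.ssubset_iff_of_subset ?_ |>.2 ⟨u, ?_, ?_⟩)
    · intro w
      simpa using fun h => Relation.TransGen.tail h huv
    · simpa using Relation.TransGen.single huv
    · simpa using hP.not_transGen_residStep j u
  refine ⟨p, fun a ha => hp _ _ ⟨a, ?_, ?_⟩, fun a ha => hp _ _ ⟨a, ?_, ?_⟩⟩ <;>
    simp only [rtail, rhead, if_pos, if_neg, ha, not_false_eq_true]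

end Residual

end KPairNetwork

namespace KPairNetwork

section Leaving

variable {N : KPairNetwork 3} {P : Fin 3 → Fin 3 → List N.A} {r r' j l t : Fin 3} {a b : N.A}

/-- The level of the vertex at which the paths from the `r`-th source to the `j`-th and to the
`l`-th sink part. -/
noncomputable def leaveLevel (P : Fin 3 → Fin 3 → List N.A) (r j l : Fin 3) : ℕ :=
  sInf {n | ∃ a, N.ord (N.tail a) = n ∧ ¬ (a ∈ P r j ↔ a ∈ P r l)}

theorem leaveLevel_comm (P : Fin 3 → Fin 3 → List N.A) (r j l : Fin 3) :
    leaveLevel P r j l = leaveLevel P r l j := by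
  simp only [leaveLevel, iff_comm]

theorem mem_iff_of_lt_leaveLevel (h : N.ord (N.tail a) < leaveLevel P r j l) :
    a ∈ P r j ↔ a ∈ P r l := by
  by_contra hne
  exact Nat.notMem_of_lt_sInf h ⟨a, rfl, hne⟩

theorem IsStableSystem.snk_notMem (hP : N.IsStableSystem P) (hjl : j ≠ l) :
    N.snk j ∉ N.pathVerts (P r l) := by
  rintro ⟨a, ha, h | h⟩
  · exact N.snk_no_out j a h.symm
  · rcases (hP.path r l).exists_tail_eq_head ha with h' | ⟨b, -, h'⟩
    · exact hjl (N.snk_inj (h.trans h'))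
    · exact N.snk_no_out j b (h'.trans h.symm)

theorem IsStableSystem.exists_ord_eq_leaveLevel (hP : N.IsStableSystem P) (r : Fin 3)
    (hjl : j ≠ l) : ∃ a, N.ord (N.tail a) = leaveLevel P r j l ∧ ¬ (a ∈ P r j ↔ a ∈ P r l) := by
  refine Nat.sInf_mem (s := {n | ∃ a, N.ord (N.tail a) = n ∧ ¬ (a ∈ P r j ↔ a ∈ P r l)}) ?_
  obtain ⟨a, ha, h⟩ := (hP.path r j).exists_head_eq
  exact ⟨_, a, rfl, fun h' =>
    hP.snk_notMem (r := r) hjl (h ▸ head_mem_pathVerts (h'.1 ha))⟩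

theorem IsStableSystem.exists_leave_aux (hP : N.IsStableSystem P)
    (ha : a ∈ P r j) (ha' : a ∉ P r l) (h : N.ord (N.tail a) = leaveLevel P r j l) :
    ∃ b ∈ P r l, b ∉ P r j ∧ N.tail b = N.tail a := by
  have hv : N.tail a ∈ N.pathVerts (P r l) := by
    rcases (hP.path r j).exists_head_eq_tail ha with h' | ⟨b, hb, h'⟩
    · obtain ⟨b, s, hb⟩ := List.exists_cons_of_ne_nil (hP.path r l).1
      have h1 := hP.path r l
      rw [hb] at h1
      rw [h', ← h1.tail_eq]
      exact tail_mem_pathVerts (by simp [hb])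
    · have h1 := N.ord_lt b
      rw [h', h] at h1
      exact h' ▸ head_mem_pathVerts ((mem_iff_of_lt_leaveLevel h1).1 hb)
  obtain ⟨b, hb, hba⟩ := (hP.path r l).exists_tail_eq hv (N.snk_no_out l a)
  exact ⟨b, hb, fun hb' => ha' ((hP.path r j).eq_of_ord_tail_eq ha hb' (by rw [hba]) ▸ hb), hba⟩

/-- Two paths from the same source part by different arcs with the same tail. -/
theorem IsStableSystem.exists_leave (hP : N.IsStableSystem P) (r : Fin 3) (hjl : j ≠ l) :
    ∃ a ∈ P r j, a ∉ P r l ∧ N.ord (N.tail a) = leaveLevel P r j l ∧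
      ∃ b ∈ P r l, b ∉ P r j ∧ N.tail b = N.tail a := by
  obtain ⟨a, h, ha⟩ := hP.exists_ord_eq_leaveLevel r hjl
  by_cases haj : a ∈ P r j
  · have hal : a ∉ P r l := fun hal => ha ⟨fun _ => hal, fun _ => haj⟩
    exact ⟨a, haj, hal, h, hP.exists_leave_aux haj hal h⟩
  · have hal : a ∈ P r l := by tauto
    obtain ⟨b, hb, hbl, hba⟩ := hP.exists_leave_aux hal haj
      (h.trans (leaveLevel_comm P r j l))
    exact ⟨b, hb, hbl, hba ▸ h, a, hal, haj, hba.symm⟩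

theorem IsStableSystem.min_le_leaveLevel (hP : N.IsStableSystem P) (r t : Fin 3) (hjl : j ≠ l) :
    min (leaveLevel P r j t) (leaveLevel P r t l) ≤ leaveLevel P r j l := by
  obtain ⟨a, h, ha⟩ := hP.exists_ord_eq_leaveLevel r hjl
  by_contra! hlt
  rw [lt_min_iff, ← h] at hlt
  exact ha ((mem_iff_of_lt_leaveLevel hlt.1).trans (mem_iff_of_lt_leaveLevel hlt.2))

/-- Among the three paths from a source, one parts first from the two others. -/
theorem IsStableSystem.exists_first (hP : N.IsStableSystem P) (r : Fin 3) :
    ∃ s : Fin 3, ∀ j l l', j ≠ l → j ≠ l' → (s = j ∨ s = l') →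
      leaveLevel P r j l' ≤ leaveLevel P r j l := by
  have h01 := hP.min_le_leaveLevel r 2 (show (0 : Fin 3) ≠ 1 by decide)
  have h02 := hP.min_le_leaveLevel r 1 (show (0 : Fin 3) ≠ 2 by decide)
  have h12 := hP.min_le_leaveLevel r 0 (show (1 : Fin 3) ≠ 2 by decide)
  have e10 := leaveLevel_comm P r 1 0
  have e20 := leaveLevel_comm P r 2 0
  have e21 := leaveLevel_comm P r 2 1
  simp only [Fin.exists_fin_succ, Fin.forall_fin_succ]
  simp [e10, e20, e21] at h01 h02 h12 ⊢
  omega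

end Leaving

end KPairNetwork

namespace KPairNetwork

section Hitting

variable {N : KPairNetwork 3} {P : Fin 3 → Fin 3 → List N.A} {r r' i i' j l t : Fin 3} {a b : N.A}

theorem IsPathFrom.exists_first_hit {u v : N.V} {q : List N.A} {p : N.V → ℕ}
    (hp : ∀ a, (¬ ∃ i, a ∈ P i j) → p (N.tail a) < p (N.head a)) (h : N.IsPathFrom u v q)
    (hq : ∀ a ∈ q.head?, ¬ ∃ i, a ∈ P i j) :
    (∀ b ∈ q, ∀ i, N.head b ∉ N.pathVerts (P i j)) ∨
      ∃ b ∈ q, ∃ i, N.head b ∈ N.pathVerts (P i j) ∧ p u < p (N.head b) := by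
  induction h using IsPathFrom.induction_on with
  | single a _ ha =>
    have h1 := hp a (hq a (by simp))
    by_cases h : ∃ i, N.head a ∈ N.pathVerts (P i j)
    · obtain ⟨i, hi⟩ := h
      exact Or.inr ⟨a, by simp, i, hi, h1⟩
    · exact Or.inl (by simpa using h)
  | cons a q _ hl ih =>
    have h1 := hp a (hq a (by simp))
    by_cases h : ∃ i, N.head a ∈ N.pathVerts (P i j)
    · obtain ⟨i, hi⟩ := h
      exact Or.inr ⟨a, by simp, i, hi, h1⟩
    · have h2 : ∀ b ∈ q.head?, ¬ ∃ i, b ∈ P i j := by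
        rintro b hb ⟨i, hi⟩
        exact h ⟨i, hl.2.2.1 b hb ▸ tail_mem_pathVerts hi⟩
      rcases ih h2 with h3 | ⟨b, hb, i, hi, h3⟩
      · refine Or.inl fun b hb => ?_
        rcases List.mem_cons.1 hb with rfl | hb
        · simpa using h
        · exact h3 b hb
      · exact Or.inr ⟨b, List.mem_cons_of_mem _ hb, i, hi, h1.trans h3⟩

/-- After parting from the path from the `r`-th source to the `j`-th sink, the path from the
`r`-th source to the `l`-th sink either avoids all paths to the `j`-th sink, or there is a first
one of them which it hits. -/
theorem IsStableSystem.exists_hit (hP : N.IsStableSystem P) (r : Fin 3) (hjl : j ≠ l)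
    {p : N.V → ℕ} (hp : ∀ a, (¬ ∃ i, a ∈ P i j) → p (N.tail a) < p (N.head a))
    (ha : a ∈ P r j) (hal : N.ord (N.tail a) = leaveLevel P r j l) :
    ∃ o : Option (Fin 3),
      (∀ b ∈ P r l, leaveLevel P r j l ≤ N.ord (N.tail b) →
        ∀ i, N.head b ∈ N.pathVerts (P i j) → o ≠ none) ∧
      ∀ i, o = some i → ∃ b ∈ P r l, leaveLevel P r j l ≤ N.ord (N.tail b) ∧
        N.head b ∈ N.pathVerts (P i j) ∧ p (N.tail a) < p (N.head b) := by
  obtain ⟨a', ha', -, hal', c, hc, hcj, hca⟩ := hP.exists_leave r hjl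
  obtain rfl := (hP.path r j).eq_of_ord_tail_eq ha ha' (hal.trans hal'.symm)
  obtain ⟨q, s, hs⟩ := List.append_of_mem hc
  have h1 := hP.path r l
  rw [hs] at h1
  have hmem : ∀ b ∈ P r l, leaveLevel P r j l ≤ N.ord (N.tail b) → b ∈ c :: s := by
    intro b hb hle
    rw [hs, List.mem_append] at hb
    refine hb.resolve_left fun hb => ?_
    have := h1.ord_tail_lt hb
    rw [hca, hal] at this
    omega
  have hnot : ∀ b ∈ (c :: s).head?, ¬ ∃ i, b ∈ P i j := by
    rintro b hb ⟨i, hi⟩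
    obtain rfl : c = b := by simpa using hb
    have := hP.eq_of_mem_pathVerts (tail_mem_pathVerts hi) (hca ▸ tail_mem_pathVerts ha)
      (N.snk_no_out j c)
    exact hcj (this ▸ hi)
  rcases h1.drop.exists_first_hit hp hnot with h | ⟨b, hb, i, hi, hlt⟩
  · exact ⟨none, fun b hb hle i hi => (h b (hmem b hb hle) i hi).elim, by simp⟩
  · refine ⟨some i, by simp, fun i' hi' => ?_⟩
    obtain rfl := Option.some.inj hi'
    refine ⟨b, hs ▸ List.mem_append_right _ hb, ?_, hi, hca ▸ hlt⟩
    rw [← hal, ← hca]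
    exact h1.ord_tail_le hb

theorem IsStableSystem.exists_arc_of_hit (hP : N.IsStableSystem P) (hjl : j ≠ l) (hr : r ≠ r')
    (hb : b ∈ P r l) (h : N.head b ∈ N.pathVerts (P r' j)) :
    ∃ c ∈ P r' j, N.head c = N.head b ∧ leaveLevel P r' j l ≤ N.ord (N.tail c) := by
  have hc : ∃ c ∈ P r' j, N.head c = N.head b := by
    obtain ⟨c, hc, h' | h'⟩ := h
    · rcases (hP.path r' j).exists_head_eq_tail hc with hc' | ⟨d, hd, hc'⟩
      · exact (N.src_no_in r' b (h'.trans hc')).elim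
      · exact ⟨d, hd, hc'.trans h'.symm⟩
    · exact ⟨c, hc, h'.symm⟩
  obtain ⟨c, hc, hcb⟩ := hc
  refine ⟨c, hc, hcb, ?_⟩
  by_contra! hlt
  have hcl : c ∈ P r' l := (mem_iff_of_lt_leaveLevel hlt).1 hc
  refine hr (hP.eq_of_mem_pathVerts (v := N.head b) (head_mem_pathVerts hb)
    (hcb ▸ head_mem_pathVerts hcl) fun hl => ?_)
  exact hP.snk_notMem (r := r') hjl.symm (hl ▸ h)

theorem IsStableSystem.potential_le (hP : N.IsStableSystem P) {p : N.V → ℕ}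
    (hp : ∀ a, (∃ i, a ∈ P i j) → p (N.head a) < p (N.tail a)) (ha : a ∈ P r j) (hb : b ∈ P r j)
    (hab : N.ord (N.tail a) ≤ N.ord (N.tail b)) : p (N.head b) < p (N.tail a) := by
  have h1 := N.ord_lt b
  have h2 := hp a ⟨r, ha⟩
  have h3 := hp b ⟨r, hb⟩
  rcases (hP.path r j).comparable (fun a ha => (hp a ⟨r, ha⟩).le) ha hb with rfl | h | h
  · exact h2
  · omega
  · omega

/-- The first hits of the paths of a stable system, and the source-wise orders of parting, subject
to the acyclicity of the residual networks. -/
theorem IsStableSystem.exists_trace (hP : N.IsStableSystem P) :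
    ∃ (F : Fin 3 → Fin 3 → Fin 3 → Option (Fin 3)) (s : Fin 3 → Fin 3),
      (∀ j, ∃ p : Fin 3 → Fin 3 → ℕ, ∀ l l' r r', j ≠ l → j ≠ l' → F j l r = some r' →
        (l' = l ∨ s r' = j ∨ s r' = l') → p r l < p r' l') ∧
      (∀ j l r r', j ≠ l → F j l r = some r' → F l j r' ≠ none) ∧
      (∀ a j l i i', j ≠ l → i ≠ i' → a ∈ P i j → a ∈ P i' l → F j l i' ≠ none) ∧
      ∀ a j l t r, j ≠ l → j ≠ t → l ≠ t → a ∈ P r j → a ∈ P r l → a ∉ P r t →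
        s r = t ∨ F j l r ≠ none := by
  choose s hs using hP.exists_first
  choose p hpE hpN using hP.exists_potential
  have hA : ∀ r j l, ∃ a, j ≠ l → a ∈ P r j ∧ N.ord (N.tail a) = leaveLevel P r j l := by
    intro r j l
    by_cases hjl : j = l
    · obtain ⟨a, -⟩ := (hP.path r j).exists_head_eq
      exact ⟨a, fun h => (h hjl).elim⟩
    · obtain ⟨a, ha, -, hal, -⟩ := hP.exists_leave r hjl
      exact ⟨a, fun _ => ⟨ha, hal⟩⟩
  choose A hA using hA
  have hF : ∀ j l r, ∃ o : Option (Fin 3), j ≠ l →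
      (∀ b ∈ P r l, leaveLevel P r j l ≤ N.ord (N.tail b) →
        ∀ i, N.head b ∈ N.pathVerts (P i j) → o ≠ none) ∧
      ∀ i, o = some i → ∃ b ∈ P r l, leaveLevel P r j l ≤ N.ord (N.tail b) ∧
        N.head b ∈ N.pathVerts (P i j) ∧ p j (N.tail (A r j l)) < p j (N.head b) := by
    intro j l r
    by_cases hjl : j = l
    · exact ⟨none, fun h => (h hjl).elim⟩
    · obtain ⟨o, ho⟩ := hP.exists_hit r hjl (hpN j) (hA r j l hjl).1 (hA r j l hjl).2
      exact ⟨o, fun _ => ho⟩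
  choose F hF using hF
  have hne : ∀ j l r, j ≠ l → F j l r ≠ some r := by
    intro j l r hjl h
    obtain ⟨b, hb, hle, hv, hlt⟩ := (hF j l r hjl).2 r h
    obtain ⟨hA1, hA2⟩ := hA r j l hjl
    have h1 := N.ord_lt b
    by_cases hsnk : N.head b = N.snk j
    · exact hP.snk_notMem hjl (hsnk ▸ head_mem_pathVerts hb)
    · obtain ⟨c, hc, hcb⟩ := (hP.path r j).exists_tail_eq hv hsnk
      have h2 := hP.potential_le (hpE j) hA1 hc (by rw [hcb, hA2]; omega)
      rcases (hP.path r j).comparable (fun a ha => (hpE j a ⟨r, ha⟩).le) hA1 hc with h3 | h3 | h3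
      · rw [hA2.symm, h3, hcb] at hle
        omega
      · have h4 := hpE j _ ⟨r, hA1⟩
        rw [hcb] at h3
        omega
      · have h4 := N.ord_lt c
        rw [hcb] at h4
        omega
  refine ⟨F, s, fun j => ⟨fun r l => p j (N.tail (A r j l)), ?_⟩, ?_, ?_, ?_⟩
  · intro l l' r r' hl hl' h hor
    obtain ⟨b, hb, -, hv, hlt⟩ := (hF j l r hl).2 r' h
    have hrr : r ≠ r' := fun e => hne j l r hl (e ▸ h)
    obtain ⟨c, hc, hcb, hle⟩ := hP.exists_arc_of_hit hl hrr hb hv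
    obtain ⟨hA1, hA2⟩ := hA r' j l' hl'
    have hcc : leaveLevel P r' j l' ≤ leaveLevel P r' j l := by
      rcases hor with rfl | hor
      · rfl
      · exact hs r' j l l' hl hl' hor
    have := hP.potential_le (hpE j) hA1 hc (by omega)
    rw [hcb] at this
    exact hlt.trans this
  · intro j l r r' hl h
    obtain ⟨b, hb, -, hv, -⟩ := (hF j l r hl).2 r' h
    have hrr : r ≠ r' := fun e => hne j l r hl (e ▸ h)
    obtain ⟨c, hc, hcb, hle⟩ := hP.exists_arc_of_hit hl hrr hb hv
    exact (hF l j r' hl.symm).1 c hc (leaveLevel_comm P r' l j ▸ hle) r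
      (hcb ▸ head_mem_pathVerts hb)
  · intro a j l i i' hl hi ha ha'
    refine (hF j l i' hl).1 a ha' ?_ i (head_mem_pathVerts ha)
    by_contra! hlt
    exact hi (hP.disjoint ha ((mem_iff_of_lt_leaveLevel hlt).2 ha'))
  · intro a j l t r hjl hjt hlt haj hal hat
    by_cases hle : leaveLevel P r j l ≤ N.ord (N.tail a)
    · exact Or.inr ((hF j l r hjl).1 a hal hle r (head_mem_pathVerts haj))
    · have h1 : leaveLevel P r j t ≤ N.ord (N.tail a) := by
        by_contra! h
        exact hat ((mem_iff_of_lt_leaveLevel h).1 haj)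
      refine Or.inl ?_
      by_contra hst
      have h2 : s r = j ∨ s r = l := by
        have key : ∀ x j l t : Fin 3, j ≠ l → j ≠ t → l ≠ t → x ≠ t → x = j ∨ x = l := by
          decide
        exact key _ _ _ _ hjl hjt hlt hst
      have := hs r j t l hjt hjl h2
      omega

end Hitting

end KPairNetwork

/-! ### The finite case analysis

A map `Fin 3 → Option (Fin 3)` is encoded in base four by a number below `64`, the digit `3`
standing for `none`.  The functions below are written for evaluation by the kernel. -/

namespace UnicastCheck

/-- The `r`-th base-four digit of `n`. -/
def dig (n r : ℕ) : ℕ := n / 4 ^ r % 4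

/-- Whether the partial map encoded by `n` is defined at `r`. -/
def mem (n r : ℕ) : Bool := !(Nat.beq (dig n r) 3)

/-- The bit mask of the set of all `p < n` with `q p`. -/
def maskOf (q : ℕ → Bool) : ℕ → ℕ
  | 0 => 0
  | n + 1 => maskOf q n ||| cond (q n) (2 ^ n) 0

/-- Call `k` on the evaluated form of `n`. -/
def force {α : Type} (n : ℕ) (k : ℕ → α) : α := Nat.rec (k 0) (fun m _ => k (Nat.succ m)) n

/-- Call `k` on the graph of `g` over `l`, with evaluated values. -/
def forceMap {α β : Type} (g : β → ℕ) : List β → (List (β × ℕ) → α) → α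
  | [], k => k []
  | b :: l, k => force (g b) fun n => forceMap g l fun t => k ((b, n) :: t)

/-- The weight, in quarters, of the detour of the `l`-th flow along the paths numbered `(l, j)`,
`(i, j)` and `(i, l)`, where `c` lists all weights in base four. -/
def wt (c l i j : ℕ) : ℤ :=
  cond (Nat.beq i l || Nat.beq j l) 0 (Int.ofNat (dig c (9 * l + 3 * i + j)))

/-- The coefficient, in quarters, of the path numbered `(i, j)` in the `l`-th flow. -/
def coef (c l i j : ℕ) : ℤ :=
  cond (Nat.beq i l)
    (cond (Nat.beq j l)
      (4 - (wt c l 0 0 + wt c l 0 1 + wt c l 0 2 + wt c l 1 0 + wt c l 1 1 + wt c l 1 2 +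
        wt c l 2 0 + wt c l 2 1 + wt c l 2 2))
      (wt c l 0 j + wt c l 1 j + wt c l 2 j))
    (cond (Nat.beq j l) (wt c l i 0 + wt c l i 1 + wt c l i 2) (-wt c l i j))

/-- The contribution of the `j`-th system of paths to the `l`-th flow on an arc with pattern
`p`. -/
def term (c l p j : ℕ) : ℤ := cond (Nat.beq (dig p j) 3) 0 (coef c l (dig p j) j)

/-- The total load, in quarters, of an arc with pattern `p`. -/
def load (c p : ℕ) : ℕ :=
  (term c 0 p 0 + term c 0 p 1 + term c 0 p 2).natAbs +
    (term c 1 p 0 + term c 1 p 1 + term c 1 p 2).natAbs +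
    (term c 2 p 0 + term c 2 p 1 + term c 2 p 2).natAbs

/-- The mask of the patterns overloaded by the weights `c`. -/
def bad (c : ℕ) : ℕ := maskOf (fun p => !(Nat.ble (load c p) 4)) 64

/-- The weights, in base four, that are used. -/
def cands : List ℕ :=
  [17678085718272, 0, 68719804672, 17609366176000, 17678085455872, 262400, 68719542272,
    17609365913600, 524800, 137439084544, 35218731827200, 17660909994240, 360777581568,
    17661979526400, 22007416684800, 4483946201088, 17885317628160, 86973088768,
    21990232834048, 17592190320640, 344671125760, 292057777408, 4398051033088]

/-- The codes of the acyclic partial maps. -/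
def forests : List ℕ := [3, 11, 13, 15, 19, 29, 30, 31, 50, 51, 57, 58, 59, 61, 62, 63]

/-- Every value of the partial map `a` lies in the domain of `b`. -/
def sub (a b : ℕ) : Bool :=
  (!(mem a 0) || mem b (dig a 0)) && (!(mem a 1) || mem b (dig a 1)) &&
    (!(mem a 2) || mem b (dig a 2))

/-- The pairs of acyclic partial maps with values in the domain of each other. -/
def pairs : List (ℕ × ℕ) :=
  (forests ×ˢ forests).filter fun q => sub q.1 q.2 && sub q.2 q.1

/-- The code of the restriction of the zero map to the domain of the partial map `n`. -/
def dom (n : ℕ) : ℕ :=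
  cond (mem n 0) 0 3 + 4 * cond (mem n 1) 0 3 + 16 * cond (mem n 2) 0 3

/-- The pairs of domains of the members of `pairs`. -/
def doms : List (ℕ × ℕ) :=
  [(3, 12), (3, 48), (3, 60), (12, 48), (15, 48), (15, 60), (12, 3), (12, 51), (15, 51),
    (48, 12), (51, 12), (51, 60), (48, 3), (48, 15), (51, 15), (60, 3), (60, 51), (60, 15),
    (63, 63)]

def fiber (h : ℕ × ℕ) : List (ℕ × ℕ) :=
  pairs.filter fun q => Nat.beq (dom q.1) h.1 && Nat.beq (dom q.2) h.2

/-- Whether an arc may have pattern `p`, in view of the paths numbered `(p j, j)` and `(p l, l)`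
being different. -/
def crossOK (j l : ℕ) (h : ℕ × ℕ) (p : ℕ) : Bool :=
  !(mem p j) || !(mem p l) || Nat.beq (dig p j) (dig p l) ||
    mem h.2 (dig p j) && mem h.1 (dig p l)

/-- Whether the paths numbered `(r, j)` and `(r, l)` do not share an arc with pattern `p` outside
the path `(r, t)`. -/
def shareOK (j l t r p : ℕ) : Bool :=
  !(Nat.beq (dig p j) r) || !(Nat.beq (dig p l) r) || Nat.beq (dig p t) r

def crossMask (j l : ℕ) (h : ℕ × ℕ) : ℕ := maskOf (crossOK j l h) 64

def shareMask (j l t r : ℕ) : ℕ := maskOf (shareOK j l t r) 64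

/-- Restrict the set of patterns `m` by `shareOK`, unless this is not justified. -/
def restrict (j l t : ℕ) (h : ℕ × ℕ) (s r m : ℕ) : ℕ :=
  cond (Nat.beq (dig s r) t || mem h.1 r && mem h.2 r) m (m &&& shareMask j l t r)

def restrictAll (j l t : ℕ) (h : ℕ × ℕ) (s m : ℕ) : ℕ :=
  restrict j l t h s 0 (restrict j l t h s 1 (restrict j l t h s 2 m))

/-- Whether there is a walk with `n` arcs starting at the node `(r, l)` in the graph of index `j`,
where `f` and `g` encode the partial maps `(j, l)` and `(j, l')`. -/
def walk (j s : ℕ) : ℕ → ℕ → ℕ → ℕ → ℕ → ℕ → Bool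
  | 0, _, _, _, _, _ => true
  | n + 1, f, g, l, l', r =>
    mem f r && (walk j s n f g l l' (dig f r) ||
      (Nat.beq (dig s (dig f r)) j || Nat.beq (dig s (dig f r)) l') &&
        walk j s n g f l' l (dig f r))

def cyclic (j s f g l l' : ℕ) : Bool :=
  walk j s 10 f g l l' 0 || walk j s 10 f g l l' 1 || walk j s 10 f g l l' 2 ||
    walk j s 10 g f l' l 0 || walk j s 10 g f l' l 1 || walk j s 10 g f l' l 2

/-- The codes of the maps `Fin 3 → Fin 3`. -/
def codes : List ℕ :=
  [0, 1, 2].flatMap fun x => [0, 1, 2].flatMap fun y => [0, 1, 2].map fun z => x + 4 * y + 16 * z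

/-- The case distinction over the domains, the maps `s` and finally the partial maps. -/
def check : Bool :=
  forceMap bad cands fun cs =>
  forceMap (crossMask 0 1) doms fun t₀ =>
  forceMap (crossMask 0 2) doms fun t₁ =>
  forceMap (crossMask 1 2) doms fun t₂ =>
  t₀.all fun h₀ => t₁.all fun h₁ => force (h₀.2 &&& h₁.2) fun m => t₂.all fun h₂ =>
    force (m &&& h₂.2) fun m =>
      (cs.take 11).any (fun c => Nat.beq (m &&& c.2) 0) ||
      codes.all fun s =>
        force (restrictAll 0 1 2 h₀.1 s (restrictAll 0 2 1 h₁.1 s (restrictAll 1 2 0 h₂.1 s m)))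
          fun m => cs.any (fun c => Nat.beq (m &&& c.2) 0) ||
            (fiber h₀.1).all fun q₀ => (fiber h₁.1).all fun q₁ => (fiber h₂.1).all fun q₂ =>
              cyclic 0 s q₀.1 q₁.1 1 2 || cyclic 1 s q₀.2 q₂.1 0 2 ||
                cyclic 2 s q₁.2 q₂.2 0 1

set_option maxRecDepth 10000 in
theorem check_eq_true : check = true := by decide +kernel

end UnicastCheck

namespace UnicastCheck

theorem testBit_maskOf (q : ℕ → Bool) (n p : ℕ) :
    (maskOf q n).testBit p = (decide (p < n) && q p) := by
  induction n with
  | zero => simp [maskOf]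
  | succ n ih =>
    have h : (cond (q n) (2 ^ n) 0).testBit p = (decide (n = p) && q n) := by
      cases q n <;> simp [Nat.testBit_two_pow]
    rw [maskOf, Nat.testBit_or, ih, h]
    rcases lt_trichotomy p n with hp | rfl | hp
    · simp [hp, hp.ne', Nat.lt_succ_of_lt hp]
    · simp
    · simp [hp.ne, not_lt.2 hp.le, not_lt.2 (Nat.succ_le_of_lt hp)]

theorem force_eq {α : Type} (n : ℕ) (k : ℕ → α) : force n k = k n := by
  cases n <;> rfl

theorem forceMap_eq {α β : Type} (g : β → ℕ) (l : List β) (k : List (β × ℕ) → α) :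
    forceMap g l k = k (l.map fun b => (b, g b)) := by
  induction l generalizing k with
  | nil => rfl
  | cons b l ih => simp [forceMap, force_eq, ih]

/-- The base-four digit representing an optional index. -/
def enc (o : Option (Fin 3)) : ℕ := o.elim 3 (fun i => (i : ℕ))

@[simp] theorem enc_none : enc none = 3 := rfl

@[simp] theorem enc_some (i : Fin 3) : enc (some i) = i := rfl

/-- The code of a partial map. -/
def code (f : Fin 3 → Option (Fin 3)) : ℕ := enc (f 0) + 4 * enc (f 1) + 16 * enc (f 2)

theorem enc_lt (o : Option (Fin 3)) : enc o < 4 := by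
  cases o with
  | none => simp
  | some i => rw [enc_some]; omega

theorem code_lt (f : Fin 3 → Option (Fin 3)) : code f < 64 := by
  have h0 := enc_lt (f 0)
  have h1 := enc_lt (f 1)
  have h2 := enc_lt (f 2)
  unfold code
  omega

@[simp] theorem dig_code (f : Fin 3 → Option (Fin 3)) (r : Fin 3) :
    dig (code f) r = enc (f r) := by
  have h0 := enc_lt (f 0)
  have h1 := enc_lt (f 1)
  have h2 := enc_lt (f 2)
  fin_cases r <;> simp [dig, code] <;> omega

@[simp] theorem mem_code (f : Fin 3 → Option (Fin 3)) (r : Fin 3) :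
    mem (code f) r = (f r).isSome := by
  rw [mem, dig_code]
  rcases f r with _ | i
  · rfl
  · revert i; decide

theorem mem_dom (n : ℕ) (r : Fin 3) : mem (dom n) r = mem n r := by
  cases h0 : mem n 0 <;> cases h1 : mem n 1 <;> cases h2 : mem n 2 <;> fin_cases r <;>
    simp_all [dom, mem, dig] <;> rfl

theorem mem_codes (s : Fin 3 → Fin 3) : code (fun r => some (s r)) ∈ codes := by
  revert s
  decide

theorem code_mem_forests {f : Fin 3 → Option (Fin 3)} {p : Fin 3 → ℕ}
    (h : ∀ r r', f r = some r' → p r < p r') : code f ∈ forests := by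
  have key : ∀ f : Fin 3 → Option (Fin 3), (∀ r, ((f r).bind f).bind f = none) →
      code f ∈ forests := by
    decide +kernel
  refine key f fun r => ?_
  by_contra hne
  obtain ⟨x, hx⟩ := Option.ne_none_iff_exists'.1 hne
  obtain ⟨b, hb, hbx⟩ := Option.bind_eq_some_iff.1 hx
  obtain ⟨a, ha, hab⟩ := Option.bind_eq_some_iff.1 hb
  have h1 := h _ _ ha
  have h2 := h _ _ hab
  have h3 := h _ _ hbx
  have hcard := Finset.card_le_univ ({r, a, b, x} : Finset (Fin 3))
  have hne' : ∀ y z, p y < p z → y ≠ z := fun y z hyz e => hyz.ne (e ▸ rfl)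
  rw [Finset.card_insert_of_notMem, Finset.card_insert_of_notMem, Finset.card_pair] at hcard
  · simp at hcard
  · exact hne' _ _ h3
  · simp [hne' _ _ h2, hne' _ _ (h2.trans h3)]
  · simp [hne' _ _ h1, hne' _ _ (h1.trans h2), hne' _ _ (h1.trans (h2.trans h3))]

theorem sub_code {f g : Fin 3 → Option (Fin 3)}
    (h : ∀ r r', f r = some r' → g r' ≠ none) : sub (code f) (code g) = true := by
  have key : ∀ r : Fin 3,
      (!(mem (code f) r) || mem (code g) (dig (code f) r)) = true := by
    intro r
    rw [mem_code, dig_code]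
    cases hr : f r with
    | none => rfl
    | some r' =>
      rw [enc_some, mem_code]
      simpa [Option.isSome_iff_ne_none] using h r r' hr
  have h0 := key 0
  have h1 := key 1
  have h2 := key 2
  simp only [Fin.val_zero, Fin.val_one, Fin.val_two] at h0 h1 h2
  simp [sub, h0, h1, h2]

theorem dom_mem_doms {q : ℕ × ℕ} (h : q ∈ pairs) : (dom q.1, dom q.2) ∈ doms := by
  revert q
  decide +kernel

theorem walk_le {j l l' : Fin 3} {s : Fin 3 → Fin 3} {F : Fin 3 → Fin 3 → Option (Fin 3)}
    {p : Fin 3 → Fin 3 → ℕ}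
    (h : ∀ m m' r r', j ≠ m → j ≠ m' → F m r = some r' → (m' = m ∨ s r' = j ∨ s r' = m') →
      p r m < p r' m') (n : ℕ) (hl : j ≠ l) (hl' : j ≠ l') (r : Fin 3)
    (hw : walk j (code fun r => some (s r)) n (code (F l)) (code (F l')) l l' r = true) :
    n ≤ (Finset.univ.filter fun y : Fin 3 × Fin 3 => p r l < p y.1 y.2).card := by
  induction n generalizing l l' r with
  | zero => exact Nat.zero_le _
  | succ n ih =>
    have step : ∀ r' m, p r l < p r' m →
        n ≤ (Finset.univ.filter fun y : Fin 3 × Fin 3 => p r' m < p y.1 y.2).card →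
        n + 1 ≤ (Finset.univ.filter fun y : Fin 3 × Fin 3 => p r l < p y.1 y.2).card := by
      intro r' m hlt hle
      refine Nat.succ_le_of_lt (hle.trans_lt (Finset.card_lt_card ?_))
      refine ⟨fun y hy => ?_, fun hsub => ?_⟩
      · simp only [Finset.mem_filter, Finset.mem_univ, true_and] at hy ⊢
        exact hlt.trans hy
      · have := @hsub (r', m) (by simpa using hlt)
        simp at this
    cases hr : F l r with
    | none => simp [walk, hr] at hw
    | some r' =>
      simp only [walk, mem_code, hr, dig_code, enc_some, Option.isSome_some, Bool.true_and,
        Bool.or_eq_true, Bool.and_eq_true, Nat.beq_eq, Fin.val_inj] at hw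
      rcases hw with hw | ⟨hs, hw⟩
      · exact step r' l (h l l r r' hl hl hr (Or.inl rfl)) (ih hl hl' r' hw)
      · exact step r' l' (h l l' r r' hl hl' hr (Or.inr hs)) (ih hl' hl r' hw)

theorem cyclic_eq_false {j l l' : Fin 3} {s : Fin 3 → Fin 3}
    {F : Fin 3 → Fin 3 → Option (Fin 3)} {p : Fin 3 → Fin 3 → ℕ}
    (h : ∀ m m' r r', j ≠ m → j ≠ m' → F m r = some r' → (m' = m ∨ s r' = j ∨ s r' = m') →
      p r m < p r' m') (hl : j ≠ l) (hl' : j ≠ l') :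
    cyclic j (code fun r => some (s r)) (code (F l)) (code (F l')) l l' = false := by
  have key : ∀ m m', j ≠ m → j ≠ m' → ∀ r : Fin 3,
      walk j (code fun r => some (s r)) 10 (code (F m)) (code (F m')) m m' r = false := by
    intro m m' hm hm' r
    by_contra hw
    have := (walk_le h 10 hm hm' r (by simpa using hw)).trans (Finset.card_le_univ _)
    simp at this
  have h1 := key l l' hl hl'
  have h2 := key l' l hl' hl
  have h10 := h1 0
  have h11 := h1 1
  have h12 := h1 2
  have h20 := h2 0
  have h21 := h2 1
  have h22 := h2 2
  simp only [Fin.val_zero, Fin.val_one, Fin.val_two] at h10 h11 h12 h20 h21 h22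
  simp [cyclic, h10, h11, h12, h20, h21, h22]

theorem beq_eq_decide (a b : ℕ) : Nat.beq a b = decide (a = b) := by
  rw [Bool.eq_iff_iff, Nat.beq_eq, decide_eq_true_iff]

theorem load_le {c m p : ℕ} (hm : m.testBit p = true) (hp : p < 64)
    (h : Nat.beq (m &&& bad c) 0 = true) : load c p ≤ 4 := by
  have h1 := congrArg (fun n => n.testBit p) (Nat.eq_of_beq_eq_true h)
  simp only [Nat.testBit_and, hm, bad, testBit_maskOf, hp, Nat.zero_testBit, decide_true,
    Bool.true_and, Bool.not_eq_false'] at h1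
  exact Nat.le_of_ble_eq_true h1

theorem exists_cand_of_fiber {h₀ h₁ h₂ : ℕ × ℕ} (hh₀ : h₀ ∈ doms) (hh₁ : h₁ ∈ doms)
    (hh₂ : h₂ ∈ doms) {s : ℕ} (hs : s ∈ codes) {q₀ q₁ q₂ : ℕ × ℕ} (hq₀ : q₀ ∈ fiber h₀)
    (hq₁ : q₁ ∈ fiber h₁) (hq₂ : q₂ ∈ fiber h₂) (hc₀ : cyclic 0 s q₀.1 q₁.1 1 2 = false)
    (hc₁ : cyclic 1 s q₀.2 q₂.1 0 2 = false) (hc₂ : cyclic 2 s q₁.2 q₂.2 0 1 = false) :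
    ∃ c, (crossMask 0 1 h₀ &&& crossMask 0 2 h₁ &&& crossMask 1 2 h₂) &&& bad c = 0 ∨
      restrictAll 0 1 2 h₀ s (restrictAll 0 2 1 h₁ s (restrictAll 1 2 0 h₂ s
        (crossMask 0 1 h₀ &&& crossMask 0 2 h₁ &&& crossMask 1 2 h₂))) &&& bad c = 0 := by
  have h := check_eq_true
  simp only [check, forceMap_eq, force_eq, List.all_eq_true, List.any_eq_true, List.mem_map,
    forall_exists_index, and_imp, Bool.or_eq_true, forall_apply_eq_imp_iff₂] at h
  rcases h h₀ hh₀ h₁ hh₁ h₂ hh₂ with ⟨c, hc, hb⟩ | h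
  · obtain ⟨c, -, rfl⟩ := List.mem_map.1 (List.mem_of_mem_take hc)
    exact ⟨c, Or.inl (Nat.eq_of_beq_eq_true hb)⟩
  · rcases h s hs with ⟨c, ⟨c, -, rfl⟩, hb⟩ | h
    · exact ⟨c, Or.inr (Nat.eq_of_beq_eq_true hb)⟩
    · have := h q₀ hq₀ q₁ hq₁ q₂ hq₂
      simp [hc₀, hc₁, hc₂] at this

theorem crossOK_code {j l : Fin 3} {a b φ : Fin 3 → Option (Fin 3)}
    (h : ∀ i i', φ j = some i → φ l = some i' → i ≠ i' → a i' ≠ none ∧ b i ≠ none) :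
    crossOK j l (dom (code a), dom (code b)) (code φ) = true := by
  simp only [crossOK, mem_code, dig_code]
  cases hj : φ j with
  | none => rfl
  | some i =>
    cases hl : φ l with
    | none => rfl
    | some i' =>
      simp only [enc_some, mem_dom, mem_code]
      by_cases hi : i = i'
      · simp [hi]
      · obtain ⟨h1, h2⟩ := h i i' hj hl hi
        simp [Option.isSome_iff_ne_none.2 h1, Option.isSome_iff_ne_none.2 h2]

theorem testBit_restrictAll {j l t : Fin 3} {a b φ : Fin 3 → Option (Fin 3)}
    {s : Fin 3 → Fin 3} {m : ℕ} (hm : m.testBit (code φ) = true)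
    (h : ∀ r, φ j = some r → φ l = some r → φ t ≠ some r →
      s r = t ∨ a r ≠ none ∧ b r ≠ none) :
    (restrictAll j l t (dom (code a), dom (code b)) (code fun r => some (s r)) m).testBit
      (code φ) = true := by
  have key : ∀ (r : Fin 3) (m : ℕ), m.testBit (code φ) = true →
      (restrict j l t (dom (code a), dom (code b)) (code fun r => some (s r)) r m).testBit
        (code φ) = true := by
    intro r m hm
    simp only [restrict, dig_code, enc_some, mem_dom, mem_code]
    by_cases hr : s r = t ∨ a r ≠ none ∧ b r ≠ none
    · have : (Nat.beq (s r) t || (a r).isSome && (b r).isSome) = true := by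
        simpa [Option.isSome_iff_ne_none, Fin.val_inj] using hr
      rw [this]
      exact hm
    · have : (Nat.beq (s r) t || (a r).isSome && (b r).isSome) = false := by
        rw [← Bool.not_eq_true]
        simpa [Option.isSome_iff_ne_none, Fin.val_inj] using hr
      rw [this, cond_false, Nat.testBit_and, hm, shareMask, testBit_maskOf]
      simp only [code_lt, decide_true, Bool.true_and, shareOK, dig_code]
      have hbeq : ∀ o : Option (Fin 3), Nat.beq (enc o) r = true ↔ o = some r := by
        rintro (_ | i)
        · simp [beq_eq_decide, r.isLt.ne']
        · simp [beq_eq_decide, Fin.val_inj]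
      by_contra hcon
      simp only [Bool.not_eq_true, Bool.or_eq_false_iff, Bool.not_eq_false', hbeq] at hcon
      rw [← Bool.not_eq_true, hbeq] at hcon
      exact hr (h r hcon.1.1 hcon.1.2 hcon.2)
  exact key 0 _ (key 1 _ (key 2 _ hm))

theorem exists_cand {F : Fin 3 → Fin 3 → Fin 3 → Option (Fin 3)} {s : Fin 3 → Fin 3}
    (hacyc : ∀ j, ∃ p : Fin 3 → Fin 3 → ℕ, ∀ l l' r r', j ≠ l → j ≠ l' → F j l r = some r' →
      (l' = l ∨ s r' = j ∨ s r' = l') → p r l < p r' l')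
    (hsub : ∀ j l r r', j ≠ l → F j l r = some r' → F l j r' ≠ none) :
    ∃ c, ∀ φ : Fin 3 → Option (Fin 3),
      (∀ j l i i', j ≠ l → i ≠ i' → φ j = some i → φ l = some i' → F j l i' ≠ none) →
      (∀ j l t r, j ≠ l → j ≠ t → l ≠ t → φ j = some r → φ l = some r → φ t ≠ some r →
        s r = t ∨ F j l r ≠ none) →
      load c (code φ) ≤ 4 := by
  choose p hp using hacyc
  have hpair : ∀ j l, j ≠ l → (code (F j l), code (F l j)) ∈ pairs := by
    intro j l hjl
    have hfor : ∀ j l, j ≠ l → code (F j l) ∈ forests := fun j l hjl =>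
      code_mem_forests (p := fun r => p j r l) fun r r' h =>
        hp j l l r r' hjl hjl h (Or.inl rfl)
    refine List.mem_filter.2 ⟨List.mem_product.2 ⟨hfor j l hjl, hfor l j hjl.symm⟩, ?_⟩
    rw [Bool.and_eq_true]
    exact ⟨sub_code fun r r' h => hsub j l r r' hjl h,
      sub_code fun r r' h => hsub l j r r' hjl.symm h⟩
  have hfib : ∀ j l, j ≠ l → (code (F j l), code (F l j)) ∈
      fiber (dom (code (F j l)), dom (code (F l j))) := fun j l hjl =>
    List.mem_filter.2 ⟨hpair j l hjl, by simp⟩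
  have h01 : (0 : Fin 3) ≠ 1 := by decide
  have h02 : (0 : Fin 3) ≠ 2 := by decide
  have h12 : (1 : Fin 3) ≠ 2 := by decide
  obtain ⟨c, hc⟩ := exists_cand_of_fiber (dom_mem_doms (hpair 0 1 h01))
    (dom_mem_doms (hpair 0 2 h02)) (dom_mem_doms (hpair 1 2 h12)) (mem_codes s)
    (hfib 0 1 h01) (hfib 0 2 h02) (hfib 1 2 h12)
    (cyclic_eq_false (j := 0) (l := 1) (l' := 2) (s := s) (hp 0) h01 h02)
    (cyclic_eq_false (j := 1) (l := 0) (l' := 2) (s := s) (hp 1) h01.symm h12)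
    (cyclic_eq_false (j := 2) (l := 0) (l' := 1) (s := s) (hp 2) h02.symm h12.symm)
  refine ⟨c, fun φ hcross hshare => ?_⟩
  have hcross' : ∀ j l : Fin 3, j ≠ l →
      (crossMask j l (dom (code (F j l)), dom (code (F l j)))).testBit (code φ) = true := by
    intro j l hjl
    rw [crossMask, testBit_maskOf, crossOK_code fun i i' hi hi' hne =>
      ⟨hcross j l i i' hjl hne hi hi', hcross l j i' i hjl.symm hne.symm hi' hi⟩]
    simp [code_lt]
  have hm : (crossMask 0 1 (dom (code (F 0 1)), dom (code (F 1 0))) &&&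
      crossMask 0 2 (dom (code (F 0 2)), dom (code (F 2 0))) &&&
      crossMask 1 2 (dom (code (F 1 2)), dom (code (F 2 1)))).testBit (code φ) = true := by
    rw [Nat.testBit_and, Nat.testBit_and, Bool.and_eq_true, Bool.and_eq_true]
    exact ⟨⟨hcross' 0 1 h01, hcross' 0 2 h02⟩, hcross' 1 2 h12⟩
  have hshare' : ∀ j l t, j ≠ l → j ≠ t → l ≠ t → ∀ r, φ j = some r → φ l = some r →
      φ t ≠ some r → s r = t ∨ F j l r ≠ none ∧ F l j r ≠ none := by
    intro j l t hjl hjt hlt r hj hl ht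
    have h1 := hshare j l t r hjl hjt hlt hj hl ht
    have h2 := hshare l j t r hjl.symm hlt hjt hl hj ht
    tauto
  rcases hc with hc | hc
  · exact load_le hm (code_lt φ) (Nat.beq_eq ▸ hc)
  · refine load_le ?_ (code_lt φ) (Nat.beq_eq ▸ hc)
    exact testBit_restrictAll (j := 0) (l := 1) (t := 2)
      (testBit_restrictAll (j := 0) (l := 2) (t := 1)
        (testBit_restrictAll (j := 1) (l := 2) (t := 0) hm
          (hshare' 1 2 0 h12 h01.symm h02.symm))
        (hshare' 0 2 1 h02 h01 h12.symm))
      (hshare' 0 1 2 h01 h02 h12)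

theorem sum_coef_left (c : ℕ) (l j : Fin 3) :
    ∑ i : Fin 3, coef c l i j = if j = l then 4 else 0 := by
  fin_cases l <;> fin_cases j <;> simp [Fin.sum_univ_three, coef, wt, beq_eq_decide] <;> ring

theorem sum_coef_right (c : ℕ) (l i : Fin 3) :
    ∑ j : Fin 3, coef c l i j = if i = l then 4 else 0 := by
  fin_cases l <;> fin_cases i <;> simp [Fin.sum_univ_three, coef, wt, beq_eq_decide] <;> ring

theorem load_code (c : ℕ) (φ : Fin 3 → Option (Fin 3)) :
    (load c (code φ) : ℤ) =
      ∑ l : Fin 3, |∑ j : Fin 3, (φ j).elim 0 fun i => coef c l i j| := by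
  have key : ∀ l j : Fin 3, term c l (code φ) j = (φ j).elim 0 fun i => coef c l i j := by
    intro l j
    rw [term, dig_code]
    cases φ j with
    | none => rfl
    | some i =>
      have : Nat.beq i 3 = false := by
        revert i; decide
      simp [this]
  simp only [Fin.sum_univ_three, load, ← key]
  push_cast
  rfl

end UnicastCheck

namespace KPairNetwork

section Unicast

variable {N : KPairNetwork 3} {P : Fin 3 → Fin 3 → List N.A}

/-- The combination of the paths of a system with given coefficients. -/
noncomputable def pathFlow (P : Fin 3 → Fin 3 → List N.A) (C : Fin 3 → Fin 3 → ℝ) : N.A → ℝ :=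
  ∑ j, ∑ i, C i j • N.unitFlow (P i j)

theorem IsStableSystem.excess_pathFlow (hP : N.IsStableSystem P) {C : Fin 3 → Fin 3 → ℝ}
    {l : Fin 3} (hl : ∀ j, ∑ i, C i j = if j = l then 1 else 0)
    (hr : ∀ i, ∑ j, C i j = if i = l then 1 else 0) (w : N.V) :
    N.excess (pathFlow P C) w =
      (if w = N.snk l then 1 else 0) - (if w = N.src l then 1 else 0) := by
  have h1 : N.excess (pathFlow P C) w =
      (∑ j, (∑ i, C i j) * if w = N.snk j then 1 else 0) -
        ∑ i, (∑ j, C i j) * if w = N.src i then 1 else 0 := by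
    simp only [pathFlow, excess_sum, excess_smul, (hP.path _ _).excess_unitFlow, mul_sub,
      Finset.sum_sub_distrib, Finset.sum_mul]
    rw [sub_right_inj, Finset.sum_comm]
  simp only [h1, hl, hr, ite_mul, one_mul, zero_mul, Finset.sum_ite_eq', Finset.mem_univ, if_true]

/-- The partial map sending `j` to the index of the path to the `j`-th sink through `a`. -/
noncomputable def pattern (P : Fin 3 → Fin 3 → List N.A) (a : N.A) (j : Fin 3) :
    Option (Fin 3) :=
  open Classical in if h : ∃ i, a ∈ P i j then some h.choose else none

theorem IsStableSystem.pattern_eq_some (hP : N.IsStableSystem P) {a : N.A} {i j : Fin 3} :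
    pattern P a j = some i ↔ a ∈ P i j := by
  rw [pattern]
  split_ifs with h
  · rw [Option.some_inj]
    exact ⟨fun e => e ▸ h.choose_spec, fun ha => hP.disjoint h.choose_spec ha⟩
  · simp only [false_iff]
    exact fun ha => h ⟨i, ha⟩

theorem IsStableSystem.pathFlow_apply (hP : N.IsStableSystem P) (C : Fin 3 → Fin 3 → ℝ)
    (a : N.A) :
    pathFlow P C a = ∑ j, (pattern P a j).elim 0 fun i => C i j := by
  simp only [pathFlow, Finset.sum_apply, Pi.smul_apply, smul_eq_mul, unitFlow]
  refine Finset.sum_congr rfl fun j _ => ?_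
  simp only [← hP.pattern_eq_some, mul_ite, mul_one, mul_zero]
  cases pattern P a j <;> simp

end Unicast

end KPairNetwork

/-- the Langberg–Médard multiple unicast conjecture for
stable 3-pair networks: every stable 3-pair network admits a feasible
multi-flow of rate `(1,1,1)`. -/
theorem statement12 (N : KPairNetwork 3) (P : Fin 3 → Fin 3 → List N.A)
    (hP : N.IsStableSystem P) :
    ∃ f : Fin 3 → N.A → ℝ,
      (∀ l, N.IsFlow (N.src l) (N.snk l) (f l)) ∧
      (∀ l, N.excess (f l) (N.snk l) = 1) ∧
      ∀ a : N.A, ∑ l : Fin 3, |f l a| ≤ 1 := by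
  obtain ⟨F, s, hacyc, hsub, hcross, hshare⟩ := hP.exists_trace
  obtain ⟨c, hc⟩ := UnicastCheck.exists_cand hacyc hsub
  have hexc := fun l : Fin 3 => hP.excess_pathFlow (l := l)
    (C := fun i j => (UnicastCheck.coef c l i j : ℝ) / 4)
    (fun j => by
      rw [← Finset.sum_div, ← Int.cast_sum, UnicastCheck.sum_coef_left]
      split_ifs <;> norm_num)
    (fun i => by
      rw [← Finset.sum_div, ← Int.cast_sum, UnicastCheck.sum_coef_right]
      split_ifs <;> norm_num)
  refine ⟨fun l => KPairNetwork.pathFlow P fun i j => (UnicastCheck.coef c l i j : ℝ) / 4,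
    fun l w hs ht => ?_, fun l => ?_, fun a => ?_⟩
  · rw [hexc, if_neg ht, if_neg hs, sub_zero]
  · rw [hexc, if_pos rfl, if_neg (hP.src_ne_snk l l).symm, sub_zero]
  · have hload := hc (KPairNetwork.pattern P a)
      (fun j l i i' hjl hne hi hi' => hcross a j l i i' hjl hne
        (hP.pattern_eq_some.1 hi) (hP.pattern_eq_some.1 hi'))
      (fun j l t r hjl hjt hlt hj hl ht => hshare a j l t r hjl hjt hlt
        (hP.pattern_eq_some.1 hj) (hP.pattern_eq_some.1 hl) (mt hP.pattern_eq_some.2 ht))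
    have habs : ∀ l : Fin 3,
        |KPairNetwork.pathFlow P (fun i j => (UnicastCheck.coef c l i j : ℝ) / 4) a| =
          ((|∑ j, (KPairNetwork.pattern P a j).elim 0 fun i => UnicastCheck.coef c l i j| : ℤ) :
            ℝ) / 4 := by
      intro l
      have h4 : |(4 : ℝ)| = 4 := abs_of_pos (by norm_num)
      rw [hP.pathFlow_apply, Int.cast_abs, Int.cast_sum, ← h4, ← abs_div, h4, Finset.sum_div]
      congr 1
      refine Finset.sum_congr rfl fun j _ => ?_
      cases KPairNetwork.pattern P a j <;> simp
    simp only [habs]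
    rw [← Finset.sum_div, ← Int.cast_sum, ← UnicastCheck.load_code, Int.cast_natCast,
      div_le_one (by norm_num)]
    exact_mod_cast hload
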